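/- (Multiple expansion formula for π_q.) Let q be a real number with 0 < q < 1, let n ≥ 1, and let x_1,…,x_n be nonzero complex numbers such that x_r/x_s is not an integer power of q^2 for r ≠ s. Then the following multiple series converges absolutely and π_q = (1 − q^2) · Σ_{k ∈ ℕ^n} ∏_{1≤r<s≤n} (1 − q^{2k_r−2k_s} x_r/x_s)/(1 − x_r/x_s) · ∏_{r=1}^n x_r^{n k_r − |k|} · (1 − q^{4|k|+2}) (q^2;q^2)_{|k|} / ∏_{r,s=1}^n (q^2 x_r/x_s; q^2)_{k_r} · (−1)^{n|k|} q^{2 Σ_{r=1}^n (r−1)k_r + 2n Σ_{r=1}^n binom(k_r,2) + 1/4} × Σ_{0 ≤ m ≤ k} ∏_{1≤r<s≤n} (1 − q^{2m_r−2m_s} x_r/x_s)/(1 − x_r/x_s) · ∏_{r,s=1}^n (q^{−2k_s} x_r/x_s; q^2)_{m_r}/(q^2 x_r/x_s; q^2)_{m_r} · (q^{2|k|+2}, q^2; q^2)_{|m|} / (q, q; q^2)_{|m|} · q^{2 Σ_{r=1}^n r m_r}. -/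

import Mathlib

open scoped BigOperators

/-- The finite q-shifted factorial `(z; q)_k = ∏_{j=0}^{k-1} (1 - z qʲ)`. -/
noncomputable def qp (q z : ℂ) (k : ℕ) : ℂ := ∏ j ∈ Finset.range k, (1 - z * q ^ j)

/-- The infinite q-shifted factorial `(z; q)_∞ = ∏_{j=0}^{∞} (1 - z qʲ)`. -/
noncomputable def qpInf (q z : ℂ) : ℂ := ∏' j : ℕ, (1 - z * q ^ j)


/-- Lagrange interpolation at the origin. -/
lemma sum_eval_mul_prod_div {n : ℕ} (y : Fin n → ℂ) (hy0 : ∀ r, y r ≠ 0)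
    (hy : Function.Injective y) (f : Polynomial ℂ) (hf : f.natDegree ≤ n) :
    ∑ r, f.eval (y r) * ∏ s ∈ Finset.univ.erase r, y s / (y s - y r) =
      f.coeff 0 - f.coeff n * ∏ s, -y s := by
  classical
  let v : Option (Fin n) → ℂ := fun o => o.elim 0 y
  have hv : Function.Injective v := by
    rintro (_ | a) (_ | b) h
    · rfl
    · exact absurd h.symm (hy0 b)
    · exact absurd h (hy0 a)
    · exact congrArg some (hy h)
  have hdeg : f.degree < (Finset.univ : Finset (Option (Fin n))).card := by
    rw [Finset.card_univ, Fintype.card_option, Fintype.card_fin]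
    refine lt_of_le_of_lt Polynomial.degree_le_natDegree ?_
    exact_mod_cast Nat.lt_succ_of_le hf
  have key := Lagrange.coeff_eq_sum (s := Finset.univ) hv.injOn hdeg
  rw [Finset.card_univ, Fintype.card_option, Fintype.card_fin, Nat.add_sub_cancel,
    Fintype.sum_option] at key
  have hnone : ∏ j ∈ (Finset.univ : Finset (Option (Fin n))).erase none, (v none - v j) =
      ∏ s, -y s := by
    have : (Finset.univ : Finset (Option (Fin n))).erase none =
        Finset.univ.map Function.Embedding.some := by
      ext (_ | a) <;> simp
    rw [this, Finset.prod_map]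
    simp [v]
  have hsome : ∀ r, ∏ j ∈ (Finset.univ : Finset (Option (Fin n))).erase (some r),
      (v (some r) - v j) = y r * ∏ s ∈ Finset.univ.erase r, (y r - y s) := by
    intro r
    have : (Finset.univ : Finset (Option (Fin n))).erase (some r) =
        insert none ((Finset.univ.erase r).map Function.Embedding.some) := by
      ext (_ | a) <;> simp
    rw [this, Finset.prod_insert (by simp), Finset.prod_map]
    simp [v]
  have hP : ∏ s, -y s ≠ 0 := Finset.prod_ne_zero_iff.2 fun s _ => neg_ne_zero.2 (hy0 s)
  rw [hnone, Finset.sum_congr rfl fun r _ => by rw [hsome r]] at key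
  rw [key, add_mul, div_mul_cancel₀ _ hP, Finset.sum_mul]
  have h0 : Polynomial.eval (v none) f = f.coeff 0 := by
    simp [v, Polynomial.coeff_zero_eq_eval_zero]
  rw [h0, sub_add_cancel_left, ← Finset.sum_neg_distrib]
  refine Finset.sum_congr rfl fun r _ => ?_
  have hprod : ∏ s, -y s = -y r * ∏ s ∈ Finset.univ.erase r, -y s :=
    (Finset.mul_prod_erase _ _ (Finset.mem_univ r)).symm
  have hdiv : ∏ s ∈ Finset.univ.erase r, y s / (y s - y r) =
      (∏ s ∈ Finset.univ.erase r, -y s) / ∏ s ∈ Finset.univ.erase r, (y r - y s) := by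
    rw [← Finset.prod_div_distrib]
    refine Finset.prod_congr rfl fun s _ => ?_
    rw [← neg_sub (y r) (y s), div_neg, neg_div]
  have hr := hy0 r
  rw [hprod, hdiv]
  change _ = -(Polynomial.eval (y r) f / _ * _)
  by_cases hz : ∏ s ∈ Finset.univ.erase r, (y r - y s) = 0
  · simp [hz]
  · field_simp

lemma natDegree_prod_one_sub {n : ℕ} (c : Fin n → ℂ) :
    (∏ s, (1 - Polynomial.C (c s) * Polynomial.X)).natDegree ≤ n := by
  refine (Polynomial.natDegree_prod_le _ _).trans ?_
  refine (Finset.sum_le_card_nsmul _ _ 1 fun s _ => ?_).trans (by simp)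
  compute_degree

lemma eval_prod_one_sub {n : ℕ} (c : Fin n → ℂ) (z : ℂ) :
    (∏ s, (1 - Polynomial.C (c s) * Polynomial.X)).eval z = ∏ s, (1 - c s * z) := by
  simp [Polynomial.eval_prod]

lemma coeff_zero_prod_one_sub {n : ℕ} (c : Fin n → ℂ) :
    (∏ s, (1 - Polynomial.C (c s) * Polynomial.X)).coeff 0 = 1 := by
  simp [Polynomial.coeff_zero_eq_eval_zero, Polynomial.eval_prod]

lemma coeff_card_prod_one_sub {n : ℕ} (c : Fin n → ℂ) :
    (∏ s, (1 - Polynomial.C (c s) * Polynomial.X)).coeff n = ∏ s, -c s := by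
  have := Polynomial.coeff_prod_of_natDegree_le (s := Finset.univ)
    (fun s => 1 - Polynomial.C (c s) * Polynomial.X) 1 fun s _ => by compute_degree
  simpa [Polynomial.coeff_one] using this

/-- Splitting off one index from a product over ordered pairs. -/
lemma prod_pairs_eq_mul {n : ℕ} (g : Fin n → Fin n → ℂ) (hg : ∀ i j, g i j = g j i) (r : Fin n) :
    (∏ i, ∏ j, if i < j then g i j else 1) =
      (∏ s ∈ Finset.univ.erase r, g r s) *
        ∏ i ∈ Finset.univ.erase r, ∏ j ∈ Finset.univ.erase r, if i < j then g i j else 1 := by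
  rw [← Finset.mul_prod_erase _ _ (Finset.mem_univ r),
    Finset.prod_congr (s₁ := Finset.univ.erase r) (g := fun i => (if i < r then g i r else 1) *
      ∏ j ∈ Finset.univ.erase r, if i < j then g i j else 1) rfl
      fun i _ => (Finset.mul_prod_erase _ _ (Finset.mem_univ r)).symm,
    ← Finset.mul_prod_erase _ _ (Finset.mem_univ r), Finset.prod_mul_distrib, ← mul_assoc,
    if_neg (lt_irrefl r), one_mul, ← Finset.prod_mul_distrib]
  congr 1
  refine Finset.prod_congr rfl fun s hs => ?_
  rcases lt_trichotomy r s with h | h | h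
  · simp [h, h.not_gt]
  · exact absurd h.symm (Finset.ne_of_mem_erase hs)
  · simp [h, h.not_gt, hg s r]

/-- The summand of the fundamental theorem of `A_n` basic hypergeometric series, with the numerator
parameters encoded in a polynomial `f`. -/
noncomputable def anTerm {n : ℕ} (Q : ℂ) (x : Fin n → ℂ) (f : Polynomial ℂ) (k : Fin n → ℕ) : ℂ :=
  (∏ i, ∏ j, if i < j then (x j * Q ^ k j - x i * Q ^ k i) / (x j - x i) else 1) *
    ∏ i, ∏ l ∈ Finset.range (k i), f.eval (x i * Q ^ l) / ∏ s, (1 - x i * Q ^ (l + 1) / x s)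

lemma anTerm_succ {n : ℕ} (Q : ℂ) (x : Fin n → ℂ) (f : Polynomial ℂ)
    (hD : ∀ r s l, 1 - x r * Q ^ (l + 1) / x s ≠ 0)
    (hy : ∀ k : Fin n → ℕ, Function.Injective fun r => x r * Q ^ k r) (r : Fin n)
    (k k' : Fin n → ℕ) (hr : k' r = k r + 1) (hoff : ∀ s ∈ Finset.univ.erase r, k' s = k s) :
    (∏ s, (1 - x r * Q ^ k' r / x s)) *
      (∏ s ∈ Finset.univ.erase r, x s * Q ^ k' s / (x s * Q ^ k' s - x r * Q ^ k' r)) *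
        anTerm Q x f k' =
    f.eval (x r * Q ^ k r) *
      (∏ s ∈ Finset.univ.erase r, x s * Q ^ k s / (x s * Q ^ k s - x r * Q ^ k r)) *
        anTerm Q x f k := by
  have hsym : ∀ (k : Fin n → ℕ) i j, (x j * Q ^ k j - x i * Q ^ k i) / (x j - x i) =
      (x i * Q ^ k i - x j * Q ^ k j) / (x i - x j) := fun k i j => by
    rw [← neg_sub (x i * Q ^ k i), ← neg_sub (x i) (x j), neg_div_neg_eq]
  have hrest : (∏ i ∈ Finset.univ.erase r, ∏ j ∈ Finset.univ.erase r, if i < j then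
        (x j * Q ^ k' j - x i * Q ^ k' i) / (x j - x i) else 1) =
      ∏ i ∈ Finset.univ.erase r, ∏ j ∈ Finset.univ.erase r, if i < j then
        (x j * Q ^ k j - x i * Q ^ k i) / (x j - x i) else 1 :=
    Finset.prod_congr rfl fun i hi => Finset.prod_congr rfl fun j hj => by
      rw [hoff i hi, hoff j hj]
  have hrest' : (∏ i ∈ Finset.univ.erase r, ∏ l ∈ Finset.range (k' i),
        f.eval (x i * Q ^ l) / ∏ s, (1 - x i * Q ^ (l + 1) / x s)) =
      ∏ i ∈ Finset.univ.erase r, ∏ l ∈ Finset.range (k i),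
        f.eval (x i * Q ^ l) / ∏ s, (1 - x i * Q ^ (l + 1) / x s) :=
    Finset.prod_congr rfl fun i hi => by rw [hoff i hi]
  have hnum : (∏ s ∈ Finset.univ.erase r,
        x s * Q ^ k' s / (x s * Q ^ k' s - x r * Q ^ k' r)) *
      (∏ s ∈ Finset.univ.erase r, (x s * Q ^ k' s - x r * Q ^ k' r) / (x s - x r)) =
      (∏ s ∈ Finset.univ.erase r, x s * Q ^ k s / (x s * Q ^ k s - x r * Q ^ k r)) *
      ∏ s ∈ Finset.univ.erase r, (x s * Q ^ k s - x r * Q ^ k r) / (x s - x r) := by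
    rw [← Finset.prod_mul_distrib, ← Finset.prod_mul_distrib]
    refine Finset.prod_congr rfl fun s hs => ?_
    have h : ∀ k : Fin n → ℕ, x s * Q ^ k s - x r * Q ^ k r ≠ 0 := fun k =>
      sub_ne_zero.2 fun h => Finset.ne_of_mem_erase hs (hy k h)
    rw [div_mul_div_cancel₀ (h k'), div_mul_div_cancel₀ (h k), hoff s hs]
  have hDr : ∏ s, (1 - x r * Q ^ k' r / x s) ≠ 0 :=
    Finset.prod_ne_zero_iff.2 fun s _ => hr ▸ hD r s _
  have hcancel := mul_div_cancel₀ (f.eval (x r * Q ^ k r)) hDr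
  rw [anTerm, anTerm, prod_pairs_eq_mul _ (hsym k') r, prod_pairs_eq_mul _ (hsym k) r, hrest,
    ← Finset.mul_prod_erase Finset.univ (fun i => ∏ l ∈ Finset.range (k' i), _)
      (Finset.mem_univ r), hrest',
    ← Finset.mul_prod_erase Finset.univ (fun i => ∏ l ∈ Finset.range (k i), _)
      (Finset.mem_univ r), hr, Finset.prod_range_succ, ← hr]
  generalize (∏ i ∈ Finset.univ.erase r, ∏ j ∈ Finset.univ.erase r, if i < j then
        (x j * Q ^ k j - x i * Q ^ k i) / (x j - x i) else 1) = R
  generalize (∏ i ∈ Finset.univ.erase r, ∏ l ∈ Finset.range (k i),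
        f.eval (x i * Q ^ l) / ∏ s, (1 - x i * Q ^ (l + 1) / x s)) = B
  generalize (∏ l ∈ Finset.range (k r),
        f.eval (x r * Q ^ l) / ∏ s, (1 - x r * Q ^ (l + 1) / x s)) = P
  generalize (∏ s, (1 - x r * Q ^ k' r / x s)) = D at *
  generalize f.eval (x r * Q ^ k r) = e at *
  rw [show ∀ a b c d : ℂ, D * a * (b * R * (P * c * d)) = (a * b) * R * P * d * (D * c) from
    fun a b c d => by ring, hnum, mul_div_cancel₀ _ hDr]
  ring

/-- The fundamental theorem of `A_n` basic hypergeometric series. -/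
theorem sum_anTerm {n : ℕ} (Q : ℂ) (hQ0 : Q ≠ 0) (hQ1 : ∀ l : ℕ, 1 - Q ^ (l + 1) ≠ 0)
    (x : Fin n → ℂ) (f : Polynomial ℂ)
    (hf : f.natDegree ≤ n) (hx0 : ∀ r, x r ≠ 0)
    (hD : ∀ r s l, 1 - x r * Q ^ (l + 1) / x s ≠ 0)
    (hy : ∀ k : Fin n → ℕ, Function.Injective fun r => x r * Q ^ k r) (K : ℕ) :
    ∑ k ∈ Finset.univ.piAntidiag K, anTerm Q x f k =
      ∏ l ∈ Finset.range K, (f.coeff 0 - f.coeff n * (∏ s, -x s) * Q ^ l) / (1 - Q ^ (l + 1)) := by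
  have hy0 : ∀ (k : Fin n → ℕ) r, x r * Q ^ k r ≠ 0 := fun k r => mul_ne_zero (hx0 r) (pow_ne_zero _ hQ0)
  induction K with
  | zero =>
    have h : ∀ i j : Fin n, (if i < j then (x j - x i) / (x j - x i) else 1) = 1 := fun i j => by
      split_ifs with hij
      · refine div_self (sub_ne_zero.2 fun h => hij.ne' (hy 0 ?_))
        simpa using h
      · rfl
    simp [anTerm, h]
  | succ K ih =>
    rw [Finset.prod_range_succ, ← ih, ← mul_div_assoc, eq_div_iff (hQ1 K), Finset.sum_mul,
      Finset.sum_mul]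
    have h1 : ∀ k ∈ Finset.univ.piAntidiag (K + 1), anTerm Q x f k * (1 - Q ^ (K + 1)) =
        ∑ r : Fin n, (∏ s, (1 - x r * Q ^ k r / x s)) *
          (∏ s ∈ Finset.univ.erase r, x s * Q ^ k s / (x s * Q ^ k s - x r * Q ^ k r)) *
            anTerm Q x f k := by
      intro k hk
      have hk' := (Finset.mem_piAntidiag.1 hk).1
      have := sum_eval_mul_prod_div _ (hy0 k) (hy k) _ (natDegree_prod_one_sub fun s => (x s)⁻¹)
      rw [coeff_zero_prod_one_sub, coeff_card_prod_one_sub, ← Finset.prod_mul_distrib,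
        Finset.prod_congr (g := fun s => Q ^ k s) rfl fun s _ => by field_simp [hx0 s],
        Finset.prod_pow_eq_pow_sum, hk'] at this
      rw [← this, Finset.mul_sum]
      refine Finset.sum_congr rfl fun r _ => ?_
      rw [eval_prod_one_sub, mul_comm]
      simp only [div_eq_inv_mul]
    have h2 : ∀ k ∈ Finset.univ.piAntidiag K,
        anTerm Q x f k * (f.coeff 0 - f.coeff n * (∏ s, -x s) * Q ^ K) =
        ∑ r : Fin n, f.eval (x r * Q ^ k r) *
          (∏ s ∈ Finset.univ.erase r, x s * Q ^ k s / (x s * Q ^ k s - x r * Q ^ k r)) *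
            anTerm Q x f k := by
      intro k hk
      have hk' := (Finset.mem_piAntidiag.1 hk).1
      have := sum_eval_mul_prod_div _ (hy0 k) (hy k) f hf
      rw [Finset.prod_congr (g := fun s => -x s * Q ^ k s) rfl fun s _ => by rw [neg_mul],
        Finset.prod_mul_distrib, Finset.prod_pow_eq_pow_sum, hk', ← mul_assoc] at this
      rw [← this, Finset.mul_sum]
      exact Finset.sum_congr rfl fun r _ => mul_comm _ _
    rw [Finset.sum_congr rfl h1, Finset.sum_congr rfl h2, Finset.sum_comm,
      Finset.sum_comm (s := Finset.univ.piAntidiag K)]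
    refine Finset.sum_congr rfl fun r _ => (Finset.sum_of_injOn (fun k => k + Pi.single r 1)
      (fun a _ b _ h => add_right_cancel h) ?_ ?_ ?_).symm
    · intro k hk
      simp only [Finset.mem_coe, Finset.mem_piAntidiag] at hk ⊢
      simp [Finset.sum_add_distrib, hk.1]
    · intro k hk hk'
      have : k r = 0 := by
        by_contra h0
        have hkr : k - Pi.single r 1 + Pi.single r 1 = k := by
          ext i
          by_cases hi : i = r
          · subst hi; simp; omega
          · simp [hi]
        refine hk' ⟨k - Pi.single r 1, ?_, ?_⟩
        · have hsum : ∑ i, (k - Pi.single r 1 + Pi.single r 1 : Fin n → ℕ) i = K + 1 := by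
            rw [hkr]; exact (Finset.mem_piAntidiag.1 hk).1
          simp only [Pi.add_apply, Finset.sum_add_distrib, Finset.sum_pi_single', Finset.mem_univ,
            if_true, Nat.add_right_cancel_iff] at hsum
          simpa using hsum
        · exact hkr
      rw [Finset.prod_eq_zero (Finset.mem_univ r) (by simp [this, hx0 r])]
      simp
    · intro k _
      refine (anTerm_succ Q x f hD hy r k _ (by simp) fun s hs => ?_).symm
      simp [Finset.ne_of_mem_erase hs]

lemma qp_ne_zero {Q z : ℂ} (h : ∀ l : ℕ, 1 - z * Q ^ l ≠ 0) (k : ℕ) : qp Q z k ≠ 0 :=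
  Finset.prod_ne_zero_iff.2 fun l _ => h l

lemma vandermonde_ratio_eq {n : ℕ} {Q : ℂ} (hQ0 : Q ≠ 0) {x : Fin n → ℂ} (hx0 : ∀ r, x r ≠ 0)
    (k : Fin n → ℕ) :
    (∏ r : Fin n, ∏ s : Fin n, if r < s then
        (1 - Q ^ ((k r : ℤ) - (k s : ℤ)) * (x r / x s)) / (1 - x r / x s) else 1) *
      Q ^ (∑ r : Fin n, (r : ℕ) * k r) =
    ∏ i, ∏ j, if i < j then (x j * Q ^ k j - x i * Q ^ k i) / (x j - x i) else 1 := by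
  have h : Q ^ (∑ r : Fin n, (r : ℕ) * k r) =
      ∏ r : Fin n, ∏ s : Fin n, if r < s then Q ^ k s else 1 := by
    rw [Finset.prod_comm, ← Finset.prod_pow_eq_pow_sum]
    refine Finset.prod_congr rfl fun s _ => ?_
    rw [← Finset.prod_filter, Finset.prod_const, Finset.filter_gt_eq_Iio, Fin.card_Iio, ← pow_mul,
      mul_comm]
  rw [h, ← Finset.prod_mul_distrib]
  refine Finset.prod_congr rfl fun r _ => ?_
  rw [← Finset.prod_mul_distrib]
  refine Finset.prod_congr rfl fun s _ => ?_
  split_ifs with hrs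
  · have hs := hx0 s
    have hs' := pow_ne_zero (k s) hQ0
    have h1 : 1 - Q ^ ((k r : ℤ) - (k s : ℤ)) * (x r / x s) =
        (x s * Q ^ k s - x r * Q ^ k r) / (x s * Q ^ k s) := by
      rw [zpow_sub₀ hQ0, zpow_natCast, zpow_natCast]
      field_simp
    rw [h1, one_sub_div hs, div_div_div_eq, div_mul_eq_mul_div, mul_comm (x s * Q ^ k s),
      mul_assoc, mul_comm (x s) (Q ^ k s), mul_div_mul_right _ _ (mul_ne_zero hs' hs)]
  · simp

lemma prod_prod_qp {n : ℕ} (Q : ℂ) (x : Fin n → ℂ) (k : Fin n → ℕ) :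
    ∏ r : Fin n, ∏ s : Fin n, qp Q (Q * x r / x s) (k r) =
      ∏ i, ∏ l ∈ Finset.range (k i), ∏ s, (1 - x i * Q ^ (l + 1) / x s) := by
  refine Finset.prod_congr rfl fun r _ => ?_
  rw [Finset.prod_comm]
  refine Finset.prod_congr rfl fun s _ => Finset.prod_congr rfl fun l _ => ?_
  rw [pow_succ]; ring

lemma anTerm_eq {n : ℕ} {Q : ℂ} (hQ0 : Q ≠ 0) {x : Fin n → ℂ} (hx0 : ∀ r, x r ≠ 0)
    (f : Polynomial ℂ) (k : Fin n → ℕ) :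
    anTerm Q x f k = (∏ r : Fin n, ∏ s : Fin n, if r < s then
        (1 - Q ^ ((k r : ℤ) - (k s : ℤ)) * (x r / x s)) / (1 - x r / x s) else 1) *
      Q ^ (∑ r : Fin n, (r : ℕ) * k r) *
      ((∏ i, ∏ l ∈ Finset.range (k i), f.eval (x i * Q ^ l)) /
        ∏ r : Fin n, ∏ s : Fin n, qp Q (Q * x r / x s) (k r)) := by
  rw [anTerm, vandermonde_ratio_eq hQ0 hx0, prod_prod_qp]
  simp only [Finset.prod_div_distrib]

lemma prod_range_neg_pow_div (Q : ℂ) (K : ℕ) :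
    ∏ l ∈ Finset.range K, (-Q ^ l) / (1 - Q ^ (l + 1)) =
      (-1) ^ K * Q ^ (K.choose 2) / qp Q Q K := by
  rw [Finset.prod_div_distrib, Finset.prod_neg, Finset.prod_pow_eq_pow_sum, Finset.card_range,
    Finset.sum_range_id, Nat.choose_two_right, qp]
  congr 1
  exact Finset.prod_congr rfl fun l _ => by rw [pow_succ']

/-- The polynomial arising from `∏ s, (1 - a s * X / x s)` as every `a s` tends to infinity. -/
noncomputable def topPoly {n : ℕ} (x : Fin n → ℂ) : Polynomial ℂ :=
  Polynomial.C ((-1) ^ n / ∏ s, x s) * Polynomial.X ^ n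

lemma prod_eval_topPoly {n : ℕ} {Q : ℂ} {x : Fin n → ℂ} (hx0 : ∀ r, x r ≠ 0) (k : Fin n → ℕ) :
    ∏ i, ∏ l ∈ Finset.range (k i), (topPoly x).eval (x i * Q ^ l) =
      (∏ r : Fin n, x r ^ ((n : ℤ) * (k r : ℤ) - ((∑ r : Fin n, k r : ℕ) : ℤ))) *
        (-1 : ℂ) ^ (n * (∑ r : Fin n, k r)) * Q ^ (n * (∑ r : Fin n, Nat.choose (k r) 2)) := by
  have h : ∀ i, ∏ l ∈ Finset.range (k i), (topPoly x).eval (x i * Q ^ l) =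
      (((-1) ^ n / ∏ s, x s) ^ k i * x i ^ (n * k i)) * Q ^ (n * Nat.choose (k i) 2) := fun i => by
    simp only [topPoly, Polynomial.eval_mul, Polynomial.eval_C, Polynomial.eval_pow,
      Polynomial.eval_X, mul_pow, Finset.prod_mul_distrib, Finset.prod_const, Finset.card_range]
    rw [← pow_mul, ← mul_assoc]
    congr 1
    rw [Finset.prod_pow, Finset.prod_pow_eq_pow_sum, Finset.sum_range_id, Nat.choose_two_right,
      ← pow_mul, mul_comm n]
  have hz : ∀ i, x i ^ ((n : ℤ) * (k i : ℤ) - ((∑ r : Fin n, k r : ℕ) : ℤ)) =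
      x i ^ (n * k i) / x i ^ (∑ r, k r) := fun i => by
    rw [zpow_sub₀ (hx0 i), zpow_natCast, ← Nat.cast_mul, zpow_natCast]
  simp only [h, hz]
  rw [Finset.prod_mul_distrib, Finset.prod_mul_distrib, Finset.prod_div_distrib,
    Finset.prod_pow_eq_pow_sum, Finset.prod_pow_eq_pow_sum, Finset.prod_pow, div_pow, ← pow_mul,
    ← Finset.mul_sum]
  ring

lemma sum_anTerm_topPoly {n : ℕ} (hn : 1 ≤ n) {Q : ℂ} (hQ0 : Q ≠ 0)
    (hQ1 : ∀ l : ℕ, 1 - Q ^ (l + 1) ≠ 0) {x : Fin n → ℂ} (hx0 : ∀ r, x r ≠ 0)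
    (hD : ∀ r s l, 1 - x r * Q ^ (l + 1) / x s ≠ 0)
    (hy : ∀ k : Fin n → ℕ, Function.Injective fun r => x r * Q ^ k r) (K : ℕ) :
    ∑ k ∈ Finset.univ.piAntidiag K, anTerm Q x (topPoly x) k =
      (-1) ^ K * Q ^ (K.choose 2) / qp Q Q K := by
  have hdeg : (topPoly x).natDegree ≤ n := Polynomial.natDegree_C_mul_X_pow_le _ _
  have h0 : (topPoly x).coeff 0 = 0 := by
    simp [topPoly, Polynomial.coeff_zero_eq_eval_zero, Nat.one_le_iff_ne_zero.1 hn]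
  have hn' : (topPoly x).coeff n = (-1) ^ n / ∏ s, x s := by simp [topPoly]
  have hprod : ∏ s, x s ≠ 0 := Finset.prod_ne_zero_iff.2 fun s _ => hx0 s
  rw [sum_anTerm Q hQ0 hQ1 x _ hdeg hx0 hD hy, h0, hn',
    ← prod_range_neg_pow_div]
  refine Finset.prod_congr rfl fun l _ => ?_
  rw [Finset.prod_neg, Finset.card_univ, Fintype.card_fin, zero_sub, div_mul_eq_mul_div,
    ← mul_assoc, ← mul_pow, neg_one_mul, neg_neg, one_pow, one_mul, div_self hprod, one_mul]

lemma sum_Iic_inner {n : ℕ} {Q : ℂ} (hQ0 : Q ≠ 0)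
    (hQ1 : ∀ l : ℕ, 1 - Q ^ (l + 1) ≠ 0) {x : Fin n → ℂ} (hx0 : ∀ r, x r ≠ 0)
    (hD : ∀ r s l, 1 - x r * Q ^ (l + 1) / x s ≠ 0)
    (hy : ∀ k : Fin n → ℕ, Function.Injective fun r => x r * Q ^ k r)
    (h : ℕ → ℂ) (k : Fin n → ℕ) :
    ∑ m ∈ Finset.Iic k,
        (∏ r : Fin n, ∏ s : Fin n, if r < s then (1 - Q ^ ((m r : ℤ) - (m s : ℤ)) * (x r / x s)) /
          (1 - x r / x s) else 1) *
        (∏ r : Fin n, ∏ s : Fin n, qp Q (Q ^ (-(k s : ℤ)) * (x r / x s)) (m r) /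
          qp Q (Q * x r / x s) (m r)) * h (∑ r : Fin n, m r) *
        Q ^ (∑ r : Fin n, ((r : ℕ) + 1) * m r) =
      ∑ M ∈ Finset.range (∑ r, k r + 1), qp Q (Q ^ (-((∑ r, k r : ℕ) : ℤ))) M / qp Q Q M * h M *
        Q ^ M := by
  set f : Polynomial ℂ := ∏ s, (1 - Polynomial.C (Q ^ (-(k s : ℤ)) / x s) * Polynomial.X) with hf
  have hfe : ∀ r l, f.eval (x r * Q ^ l) = ∏ s, (1 - Q ^ (-(k s : ℤ)) * (x r / x s) * Q ^ l) :=
    fun r l => by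
      rw [hf, eval_prod_one_sub]
      exact Finset.prod_congr rfl fun s _ => by ring
  have hterm : ∀ m : Fin n → ℕ,
      (∏ r : Fin n, ∏ s : Fin n, if r < s then (1 - Q ^ ((m r : ℤ) - (m s : ℤ)) * (x r / x s)) /
          (1 - x r / x s) else 1) *
        (∏ r : Fin n, ∏ s : Fin n, qp Q (Q ^ (-(k s : ℤ)) * (x r / x s)) (m r) /
          qp Q (Q * x r / x s) (m r)) * h (∑ r : Fin n, m r) *
        Q ^ (∑ r : Fin n, ((r : ℕ) + 1) * m r) =
      anTerm Q x f m * (h (∑ r, m r) * Q ^ (∑ r, m r)) := fun m => by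
    have h1 : ∏ i, ∏ l ∈ Finset.range (m i), f.eval (x i * Q ^ l) =
        ∏ r : Fin n, ∏ s : Fin n, qp Q (Q ^ (-(k s : ℤ)) * (x r / x s)) (m r) := by
      refine Finset.prod_congr rfl fun r _ => ?_
      simp only [hfe, qp]
      exact Finset.prod_comm
    rw [anTerm_eq hQ0 hx0, h1]
    simp only [Finset.prod_div_distrib, add_mul, one_mul, Finset.sum_add_distrib, pow_add]
    ring
  have hmaps : ∀ m ∈ Finset.Iic k, ∑ r, m r ∈ Finset.range (∑ r, k r + 1) := fun m hm =>
    Finset.mem_range_succ_iff.2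
      (Finset.sum_le_sum fun r _ => (show m ≤ k from Finset.mem_Iic.1 hm) r)
  rw [Finset.sum_congr rfl fun m _ => hterm m,
    ← Finset.sum_fiberwise_of_maps_to hmaps]
  refine Finset.sum_congr rfl fun M _ => ?_
  have hsub : ∑ m ∈ Finset.Iic k with ∑ r, m r = M,
        anTerm Q x f m * (h (∑ r, m r) * Q ^ (∑ r, m r)) =
      ∑ m ∈ Finset.univ.piAntidiag M, anTerm Q x f m * (h M * Q ^ M) := by
    refine Finset.sum_subset_zero_on_sdiff (fun m hm => ?_) (fun m hm => ?_) fun m hm => ?_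
    · simpa using (Finset.mem_filter.1 hm).2
    · obtain ⟨hm1, hm2⟩ := Finset.mem_sdiff.1 hm
      have hnot : ¬ m ≤ k := fun hle => hm2 <| Finset.mem_filter.2
        ⟨Finset.mem_Iic.2 hle, (Finset.mem_piAntidiag.1 hm1).1⟩
      obtain ⟨r, hr⟩ := not_forall.1 hnot
      have : anTerm Q x f m = 0 := by
        refine mul_eq_zero_of_right _ <| Finset.prod_eq_zero (Finset.mem_univ r) <|
          Finset.prod_eq_zero (Finset.mem_range.2 (not_le.1 hr)) ?_
        rw [hfe, Finset.prod_eq_zero (Finset.mem_univ r), zero_div]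
        rw [div_self (hx0 r), mul_one, zpow_neg, zpow_natCast,
          inv_mul_cancel₀ (pow_ne_zero _ hQ0), sub_self]
      rw [this, zero_mul]
    · rw [(Finset.mem_filter.1 hm).2]
  have hX : ∏ s, -(Q ^ (-(k s : ℤ)) / x s) * -x s = Q ^ (-((∑ r, k r : ℕ) : ℤ)) := by
    rw [Finset.prod_congr (g := fun s => (Q ^ k s)⁻¹) rfl fun s _ => by
      have := hx0 s
      rw [neg_mul_neg, div_mul_cancel₀ _ this, zpow_neg, zpow_natCast]]
    rw [Finset.prod_inv_distrib, Finset.prod_pow_eq_pow_sum, zpow_neg, zpow_natCast]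
  rw [hsub, ← Finset.sum_mul, sum_anTerm Q hQ0 hQ1 x f (natDegree_prod_one_sub _) hx0 hD hy,
    hf, coeff_zero_prod_one_sub, coeff_card_prod_one_sub, ← Finset.prod_mul_distrib, hX,
    Finset.prod_div_distrib, qp, qp, mul_assoc]
  simp only [pow_succ']

lemma qp_zero (Q z : ℂ) : qp Q z 0 = 1 := Finset.prod_range_zero _

lemma qp_succ (Q z : ℂ) (k : ℕ) : qp Q z (k + 1) = qp Q z k * (1 - z * Q ^ k) :=
  Finset.prod_range_succ _ _

lemma qp_self_succ (Q : ℂ) (k : ℕ) : qp Q Q (k + 1) = qp Q Q k * (1 - Q ^ (k + 1)) := by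
  rw [qp_succ, pow_succ']

lemma qp_succ' (Q z : ℂ) (k : ℕ) : qp Q z (k + 1) = (1 - z) * qp Q (z * Q) k := by
  rw [qp, Finset.prod_range_succ', mul_comm, pow_zero, mul_one, qp]
  congr 1
  exact Finset.prod_congr rfl fun j _ => by ring

lemma qp_self_add (Q : ℂ) (K M : ℕ) : qp Q Q (K + M) = qp Q Q K * qp Q (Q ^ (K + 1)) M := by
  rw [qp, Finset.prod_range_add, qp, qp]
  congr 1
  exact Finset.prod_congr rfl fun j _ => by ring

lemma qp_neg_pow {Q : ℂ} (hQ0 : Q ≠ 0) (M j : ℕ) :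
    qp Q (Q ^ (-((M + j : ℕ) : ℤ))) M * Q ^ ((M + j).choose 2 + M) * (-1) ^ M * qp Q Q j =
      Q ^ (j.choose 2) * qp Q Q (M + j) := by
  induction M with
  | zero => simp [qp_zero]
  | succ M ih =>
    have h1 : Q ^ (-((M + 1 + j : ℕ) : ℤ)) * Q = Q ^ (-((M + j : ℕ) : ℤ)) := by
      rw [← zpow_add_one₀ hQ0]
      congr 1
      push_cast
      ring
    have h2 : Q ^ (-((M + 1 + j : ℕ) : ℤ)) * Q ^ (M + j + 1) = 1 := by
      rw [zpow_neg, zpow_natCast, show M + 1 + j = M + j + 1 by ring,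
        inv_mul_cancel₀ (pow_ne_zero _ hQ0)]
    have h3 : (M + 1 + j).choose 2 + (M + 1) = ((M + j).choose 2 + M) + (M + j + 1) := by
      rw [show M + 1 + j = M + j + 1 by ring, Nat.choose_succ_succ' (M + j) 1, Nat.choose_one_right]
      ring
    rw [qp_succ', h1, h3, show M + 1 + j = M + j + 1 by ring, qp_self_succ, ← mul_assoc (Q ^ _), ← ih,
      pow_add Q _ (M + j + 1), pow_succ (-1 : ℂ), ← show M + 1 + j = M + j + 1 by ring]
    rw [show M + 1 + j = M + j + 1 by ring] at h2 ⊢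
    linear_combination (qp Q (Q ^ (-((M + j : ℕ) : ℤ))) M * Q ^ ((M + j).choose 2 + M) * (-1) ^ M *
      qp Q Q j) * h2

/-- The partial sums of the one-dimensional expansion in closed form. -/
noncomputable def partialExpansion (Q : ℂ) (c : ℕ → ℂ) (N : ℕ) : ℂ :=
  ∑ M ∈ Finset.range N, (-1) ^ (N - 1 - M) * Q ^ ((N - M).choose 2) * qp Q Q (N + M) /
    qp Q Q (N - 1 - M) * c M

lemma partialExpansion_succ_sub {Q : ℂ} (hQ0 : Q ≠ 0) (hQ1 : ∀ l : ℕ, 1 - Q ^ (l + 1) ≠ 0)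
    (c : ℕ → ℂ) (K : ℕ) :
    partialExpansion Q c (K + 1) - partialExpansion Q c K =
      (1 - Q ^ (2 * K + 1)) * (-1) ^ K * Q ^ (K.choose 2) *
        ∑ M ∈ Finset.range (K + 1), qp Q (Q ^ (-(K : ℤ))) M * qp Q (Q ^ (K + 1)) M * c M * Q ^ M := by
  have hne : ∀ k, qp Q Q k ≠ 0 := qp_ne_zero fun l => by simpa [pow_succ'] using hQ1 l
  have hterm : ∀ M j, (1 - Q ^ (2 * (M + j) + 1)) * (-1) ^ (M + j) * Q ^ ((M + j).choose 2) *
      (qp Q (Q ^ (-((M + j : ℕ) : ℤ))) M * qp Q (Q ^ (M + j + 1)) M * c M * Q ^ M) =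
      (1 - Q ^ (2 * (M + j) + 1)) * (-1) ^ j * Q ^ (j.choose 2) * qp Q Q (M + j + M) / qp Q Q j *
        c M := fun M j => by
    have h := qp_neg_pow hQ0 M j
    have h' := qp_self_add Q (M + j) M
    rw [h', div_mul_eq_mul_div, eq_div_iff (hne j)]
    rw [pow_add Q _ M] at h
    linear_combination ((1 - Q ^ (2 * (M + j) + 1)) * (-1) ^ j * qp Q (Q ^ (M + j + 1)) M * c M) * h
  rw [partialExpansion, partialExpansion, Finset.sum_range_succ, Finset.sum_range_succ, mul_add,
    Finset.mul_sum, add_sub_right_comm, ← Finset.sum_sub_distrib]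
  congr 1
  · refine Finset.sum_congr rfl fun M hM => ?_
    obtain ⟨j, rfl⟩ := Nat.exists_eq_add_of_lt (Finset.mem_range.1 hM)
    have ht := hterm M (j + 1)
    rw [← add_assoc] at ht
    rw [ht, show M + j + 1 + 1 - 1 - M = j + 1 by omega, show M + j + 1 + 1 - M = j + 1 + 1 by omega,
      show M + j + 1 - 1 - M = j by omega, show M + j + 1 - M = j + 1 by omega,
      show M + j + 1 + 1 + M = M + j + 1 + M + 1 by omega, qp_self_succ Q (M + j + 1 + M),
      qp_self_succ Q j, Nat.choose_succ_succ' (j + 1) 1, Nat.choose_one_right]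
    have h1 := hne j
    have h2 := hQ1 j
    field_simp
    ring
  · have ht := hterm K 0
    simp only [add_zero, pow_zero, Nat.choose_zero_succ, qp_zero, div_one, mul_one] at ht
    rw [ht]
    rw [show K + 1 - 1 - K = 0 by omega, show K + 1 - K = 1 by omega,
      show K + 1 + K = K + K + 1 by omega, qp_self_succ, two_mul, qp_zero,
      Nat.choose_eq_zero_of_lt one_lt_two]
    ring

lemma sum_antidiagonal_qbinomial {Q : ℂ} (hQ1 : ∀ l : ℕ, 1 - Q ^ (l + 1) ≠ 0) (z : ℂ) (N : ℕ) :
    ∑ p ∈ Finset.HasAntidiagonal.antidiagonal N, (-1) ^ p.1 * Q ^ (p.1.choose 2) * z ^ p.1 /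
      (qp Q Q p.1 * qp Q Q p.2) = qp Q z N / qp Q Q N := by
  have hne : ∀ k, qp Q Q k ≠ 0 := qp_ne_zero fun l => by simpa [pow_succ'] using hQ1 l
  induction N with
  | zero => simp [qp_zero]
  | succ N ih =>
    set t : ℕ × ℕ → ℂ := fun p => (-1) ^ p.1 * Q ^ (p.1.choose 2) * z ^ p.1 /
      (qp Q Q p.1 * qp Q Q p.2) with ht
    have h1 : ∑ p ∈ Finset.HasAntidiagonal.antidiagonal (N + 1), (1 - Q ^ p.2) * t p =
        ∑ p ∈ Finset.HasAntidiagonal.antidiagonal N, t p := by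
      rw [Finset.Nat.sum_antidiagonal_succ']
      simp only [pow_zero, sub_self, zero_mul, zero_add]
      refine Finset.sum_congr rfl fun p _ => ?_
      simp only [ht, qp_self_succ]
      have := hne p.1; have := hne p.2; have := hQ1 p.2
      field_simp
    have h2 : ∑ p ∈ Finset.HasAntidiagonal.antidiagonal (N + 1), Q ^ p.2 * (1 - Q ^ p.1) * t p =
        -z * Q ^ N * ∑ p ∈ Finset.HasAntidiagonal.antidiagonal N, t p := by
      rw [Finset.Nat.sum_antidiagonal_succ]
      simp only [pow_zero, sub_self, zero_mul, mul_zero, zero_add, Finset.mul_sum]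
      refine Finset.sum_congr rfl fun p hp => ?_
      rw [← Finset.HasAntidiagonal.mem_antidiagonal.1 hp]
      simp only [ht, qp_self_succ, Nat.choose_succ_succ' p.1 1, Nat.choose_one_right]
      have := hne p.1; have := hne p.2; have := hQ1 p.1
      field_simp
      ring
    have h3 : (1 - Q ^ (N + 1)) * ∑ p ∈ Finset.HasAntidiagonal.antidiagonal (N + 1), t p =
        (1 - z * Q ^ N) * ∑ p ∈ Finset.HasAntidiagonal.antidiagonal N, t p := by
      rw [show (1 - z * Q ^ N) * ∑ p ∈ Finset.HasAntidiagonal.antidiagonal N, t p =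
        ∑ p ∈ Finset.HasAntidiagonal.antidiagonal N, t p + -z * Q ^ N * ∑ p ∈ Finset.HasAntidiagonal.antidiagonal N, t p by ring,
        ← h2, ← h1, ← Finset.sum_add_distrib, Finset.mul_sum]
      refine Finset.sum_congr rfl fun p hp => ?_
      rw [← Finset.HasAntidiagonal.mem_antidiagonal.1 hp, pow_add]
      ring
    rw [ih] at h3
    have := hne N; have := hQ1 N
    rw [qp_succ, qp_self_succ, eq_div_iff (mul_ne_zero (hne N) (hQ1 N)), mul_comm (qp Q Q N),
      ← mul_assoc, mul_comm _ (1 - Q ^ (N + 1)), h3]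
    field_simp

lemma sum_range_qbinomial_self {Q : ℂ} (hQ1 : ∀ l : ℕ, 1 - Q ^ (l + 1) ≠ 0) (N : ℕ) :
    ∑ j ∈ Finset.range (N + 1), (-1) ^ j * Q ^ ((j + 1).choose 2) /
      (qp Q Q j * qp Q Q (N - j)) = 1 := by
  have hne : ∀ k, qp Q Q k ≠ 0 := qp_ne_zero fun l => by simpa [pow_succ'] using hQ1 l
  refine Eq.trans ?_ ((sum_antidiagonal_qbinomial hQ1 Q N).trans (div_self (hne N)))
  rw [Finset.Nat.sum_antidiagonal_eq_sum_range_succ_mk]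
  refine Finset.sum_congr rfl fun j _ => ?_
  simp only [Nat.choose_succ_succ' j 1, Nat.choose_one_right, pow_add]
  ring

open Filter Topology in
lemma tendsto_qp {Q : ℂ} (hQ : ‖Q‖ < 1) (z : ℂ) :
    Tendsto (qp Q z) atTop (𝓝 (qpInf Q z)) := by
  have hs : Summable fun j : ℕ => ‖-(z * Q ^ j)‖ := by
    simp only [norm_neg, norm_mul, norm_pow]
    exact (summable_geometric_of_lt_one (norm_nonneg _) hQ).mul_left _
  have := (multipliable_one_add_of_summable hs).hasProd.tendsto_prod_nat
  simp only [← sub_eq_add_neg] at this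
  exact this

lemma qpInf_ne_zero {Q : ℂ} (hQ : ‖Q‖ < 1) {z : ℂ} (h : ∀ l : ℕ, 1 - z * Q ^ l ≠ 0) :
    qpInf Q z ≠ 0 := by
  have hs : Summable fun j : ℕ => ‖-(z * Q ^ j)‖ := by
    simp only [norm_neg, norm_mul, norm_pow]
    exact (summable_geometric_of_lt_one (norm_nonneg _) hQ).mul_left _
  have := tprod_one_add_ne_zero_of_summable (f := fun j : ℕ => -(z * Q ^ j))
    (fun j => by simpa only [← sub_eq_add_neg] using h j) hs
  simpa only [← sub_eq_add_neg, qpInf] using this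

open Filter Topology in
lemma exists_norm_le_of_tendsto {u : ℕ → ℂ} {a : ℂ} (h : Tendsto u atTop (𝓝 a)) :
    ∃ C : ℝ, 0 ≤ C ∧ ∀ N, ‖u N‖ ≤ C := by
  obtain ⟨C, hC⟩ := h.norm.bddAbove_range
  exact ⟨C, (norm_nonneg _).trans (hC ⟨0, rfl⟩), fun N => hC ⟨N, rfl⟩⟩

lemma exists_norm_inv_qp_le {Q : ℂ} (hQ : ‖Q‖ < 1) {z : ℂ} (h : ∀ l : ℕ, 1 - z * Q ^ l ≠ 0) :
    ∃ C : ℝ, 0 ≤ C ∧ ∀ N, ‖(qp Q z N)⁻¹‖ ≤ C :=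
  exists_norm_le_of_tendsto ((tendsto_qp hQ z).inv₀ (qpInf_ne_zero hQ h))

/-- Convergence of `u` to `a` at geometric rate `r`. -/
def GeomTendsto (r : ℝ) (u : ℕ → ℂ) (a : ℂ) : Prop :=
  ∃ C : ℝ, 0 ≤ C ∧ ∀ N, ‖u N - a‖ ≤ C * r ^ N

open Filter Topology in
lemma GeomTendsto.tendsto {r : ℝ} (hr0 : 0 ≤ r) (hr1 : r < 1) {u : ℕ → ℂ} {a : ℂ}
    (h : GeomTendsto r u a) : Tendsto u atTop (𝓝 a) := by
  obtain ⟨C, -, hC⟩ := h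
  refine tendsto_iff_norm_sub_tendsto_zero.2 (squeeze_zero (fun _ => norm_nonneg _) hC ?_)
  simpa using (tendsto_pow_atTop_nhds_zero_of_lt_one hr0 hr1).const_mul C

lemma GeomTendsto.mul {r : ℝ} (hr0 : 0 ≤ r) (hr1 : r < 1) {u v : ℕ → ℂ} {a b : ℂ}
    (hu : GeomTendsto r u a) (hv : GeomTendsto r v b) :
    GeomTendsto r (fun N => u N * v N) (a * b) := by
  obtain ⟨B, hB0, hB⟩ := exists_norm_le_of_tendsto (hu.tendsto hr0 hr1)
  obtain ⟨C, hC0, hC⟩ := hu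
  obtain ⟨D, hD0, hD⟩ := hv
  refine ⟨B * D + C * ‖b‖, by positivity, fun N => ?_⟩
  calc ‖u N * v N - a * b‖ = ‖u N * (v N - b) + (u N - a) * b‖ := by ring_nf
    _ ≤ ‖u N‖ * ‖v N - b‖ + ‖u N - a‖ * ‖b‖ := by
      rw [← norm_mul, ← norm_mul]; exact norm_add_le _ _
    _ ≤ B * (D * r ^ N) + C * r ^ N * ‖b‖ := by gcongr <;> solve_by_elim
    _ = _ := by ring

lemma GeomTendsto.inv {r : ℝ} (hr0 : 0 ≤ r) (hr1 : r < 1) {u : ℕ → ℂ} {a : ℂ}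
    (hu : GeomTendsto r u a) (ha : a ≠ 0) (hu0 : ∀ N, u N ≠ 0) :
    GeomTendsto r (fun N => (u N)⁻¹) a⁻¹ := by
  obtain ⟨B, hB0, hB⟩ := exists_norm_le_of_tendsto ((hu.tendsto hr0 hr1).inv₀ ha)
  obtain ⟨C, hC0, hC⟩ := hu
  refine ⟨B * C * ‖a⁻¹‖, by positivity, fun N => ?_⟩
  calc ‖(u N)⁻¹ - a⁻¹‖ = ‖(u N)⁻¹‖ * ‖u N - a‖ * ‖a⁻¹‖ := by
        rw [inv_sub_inv (hu0 N) ha, ← norm_mul, ← norm_mul, ← norm_neg]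
        congr 1
        have := hu0 N
        field_simp
        ring
    _ ≤ B * (C * r ^ N) * ‖a⁻¹‖ := by gcongr <;> solve_by_elim
    _ = _ := by ring

lemma geomTendsto_qp {Q : ℂ} (hQ : ‖Q‖ < 1) (z : ℂ) : GeomTendsto ‖Q‖ (qp Q z) (qpInf Q z) := by
  obtain ⟨B, hB0, hB⟩ := exists_norm_le_of_tendsto (tendsto_qp hQ z)
  have h1 : 0 < 1 - ‖Q‖ := sub_pos.2 hQ
  refine ⟨B * ‖z‖ / (1 - ‖Q‖), by positivity, fun N => ?_⟩
  rw [← dist_eq_norm, div_mul_eq_mul_div]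
  refine dist_le_of_le_geometric_of_tendsto ‖Q‖ (B * ‖z‖) hQ (fun k => ?_) (tendsto_qp hQ z) N
  rw [dist_eq_norm, qp_succ, show qp Q z k - qp Q z k * (1 - z * Q ^ k) = qp Q z k * z * Q ^ k by ring,
    norm_mul, norm_mul, norm_pow]
  gcongr
  exact hB k

lemma summable_pow_choose_two {r : ℝ} (hr0 : 0 ≤ r) (hr1 : r < 1) :
    Summable fun j : ℕ => r ^ (j.choose 2) := by
  rw [← summable_nat_add_iff 2]
  refine Summable.of_nonneg_of_le (fun _ => by positivity) (fun j => ?_)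
    (summable_geometric_of_lt_one hr0 hr1)
  refine pow_le_pow_of_le_one hr0 hr1.le ?_
  rw [Nat.choose_succ_succ' (j + 1) 1, Nat.choose_one_right]
  omega

lemma partialExpansion_succ_eq (Q : ℂ) (hQ1 : ∀ l : ℕ, 1 - Q ^ (l + 1) ≠ 0) (c : ℕ → ℂ) (N : ℕ) :
    partialExpansion Q c (N + 1) = ∑ j ∈ Finset.range (N + 1), (-1) ^ j * Q ^ ((j + 1).choose 2) /
      (qp Q Q j * qp Q Q (N - j)) * (qp Q Q (N - j) * c (N - j) * qp Q Q (N + (N - j) + 1)) := by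
  have hne : ∀ k, qp Q Q k ≠ 0 := qp_ne_zero fun l => by simpa [pow_succ'] using hQ1 l
  rw [partialExpansion, ← Finset.sum_range_reflect]
  refine Finset.sum_congr rfl fun j hj => ?_
  have hj' := Finset.mem_range_succ_iff.1 hj
  rw [show N + 1 - 1 - j = N - j by omega, show N + 1 - 1 - (N - j) = j by omega,
    show N + 1 - (N - j) = j + 1 by omega, show N + 1 + (N - j) = N + (N - j) + 1 by omega]
  have := hne j; have := hne (N - j)
  field_simp

lemma geomTendsto_partialExpansion {Q : ℂ} (hQ : ‖Q‖ < 1)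
    (hQ1 : ∀ l : ℕ, 1 - Q ^ (l + 1) ≠ 0) {c : ℕ → ℂ} {a : ℂ} (hc : GeomTendsto ‖Q‖ c a) :
    GeomTendsto ‖Q‖ (fun N => partialExpansion Q c (N + 1)) (qpInf Q Q * a * qpInf Q Q) := by
  have hQn := norm_nonneg Q
  have hqp := geomTendsto_qp hQ Q
  obtain ⟨E, hE0, hE⟩ := exists_norm_inv_qp_le (z := Q) hQ fun l => by
    simpa [pow_succ'] using hQ1 l
  obtain ⟨U, hU0, hU⟩ := hqp.mul hQn hQ hc
  obtain ⟨V, hV0, hV⟩ := hqp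
  obtain ⟨B, hB0, hB⟩ := exists_norm_le_of_tendsto (tendsto_qp hQ Q)
  set L := qpInf Q Q * a with hL
  have hb : ∀ N j, ‖qp Q Q (N - j) * c (N - j) * qp Q Q (N + (N - j) + 1) - L * qpInf Q Q‖ ≤
      (U * B + ‖L‖ * V) * ‖Q‖ ^ (N - j) := fun N j => by
    calc _ = ‖(qp Q Q (N - j) * c (N - j) - L) * qp Q Q (N + (N - j) + 1) +
          L * (qp Q Q (N + (N - j) + 1) - qpInf Q Q)‖ := by ring_nf
      _ ≤ ‖qp Q Q (N - j) * c (N - j) - L‖ * ‖qp Q Q (N + (N - j) + 1)‖ +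
          ‖L‖ * ‖qp Q Q (N + (N - j) + 1) - qpInf Q Q‖ := by
        rw [← norm_mul, ← norm_mul]; exact norm_add_le _ _
      _ ≤ U * ‖Q‖ ^ (N - j) * B + ‖L‖ * (V * ‖Q‖ ^ (N - j)) := by
        gcongr
        · exact hU _
        · exact hB _
        · exact (hV _).trans (mul_le_mul_of_nonneg_left
            (pow_le_pow_of_le_one hQn hQ.le (by omega)) hV0)
      _ = _ := by ring
  have hS := summable_pow_choose_two hQn hQ
  set S := ∑' j : ℕ, ‖Q‖ ^ (j.choose 2) with hSdef
  have hS0 : 0 ≤ S := tsum_nonneg fun _ => by positivity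
  refine ⟨E * E * (U * B + ‖L‖ * V) * S, by positivity, fun N => ?_⟩
  have hdiff : partialExpansion Q c (N + 1) - L * qpInf Q Q =
      ∑ j ∈ Finset.range (N + 1), (-1) ^ j * Q ^ ((j + 1).choose 2) /
      (qp Q Q j * qp Q Q (N - j)) *
        (qp Q Q (N - j) * c (N - j) * qp Q Q (N + (N - j) + 1) - L * qpInf Q Q) := by
    simp only [mul_sub, Finset.sum_sub_distrib]
    rw [← Finset.sum_mul, sum_range_qbinomial_self hQ1, one_mul, partialExpansion_succ_eq Q hQ1]
  rw [hdiff]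
  calc _ ≤ ∑ j ∈ Finset.range (N + 1), E * E * (U * B + ‖L‖ * V) * ‖Q‖ ^ N * ‖Q‖ ^ (j.choose 2) := by
        refine norm_sum_le_of_le _ fun j hj => ?_
        have hj' := Finset.mem_range_succ_iff.1 hj
        have hpow : ‖Q‖ ^ ((j + 1).choose 2) * ‖Q‖ ^ (N - j) = ‖Q‖ ^ N * ‖Q‖ ^ (j.choose 2) := by
          rw [← pow_add, ← pow_add, show (j + 1).choose 2 = j + j.choose 2 by
            rw [Nat.choose_succ_succ' j 1, Nat.choose_one_right]]
          congr 1
          omega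
        calc _ = ‖Q‖ ^ ((j + 1).choose 2) * (‖(qp Q Q j)⁻¹‖ * ‖(qp Q Q (N - j))⁻¹‖ *
              ‖qp Q Q (N - j) * c (N - j) * qp Q Q (N + (N - j) + 1) - L * qpInf Q Q‖) := by
              rw [norm_mul, norm_div, norm_mul, norm_mul, norm_pow, norm_pow, norm_neg, norm_one,
                one_pow, norm_inv, norm_inv, div_eq_mul_inv, mul_inv]
              ring
          _ ≤ ‖Q‖ ^ ((j + 1).choose 2) * (E * E * ((U * B + ‖L‖ * V) * ‖Q‖ ^ (N - j))) := by
              gcongr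
              · exact hE _
              · exact hE _
              · exact hb N j
          _ = E * E * (U * B + ‖L‖ * V) * (‖Q‖ ^ ((j + 1).choose 2) * ‖Q‖ ^ (N - j)) := by ring
          _ = _ := by rw [hpow]; ring
    _ ≤ E * E * (U * B + ‖L‖ * V) * ‖Q‖ ^ N * S := by
        rw [← Finset.mul_sum]
        gcongr
        exact hS.sum_le_tsum _ fun _ _ => by positivity
    _ = _ := by ring

lemma hasSum_expansion {Q : ℂ} (hQ0 : Q ≠ 0) (hQ : ‖Q‖ < 1)
    (hQ1 : ∀ l : ℕ, 1 - Q ^ (l + 1) ≠ 0) {c : ℕ → ℂ} {a : ℂ} (hc : GeomTendsto ‖Q‖ c a) :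
    (∃ C : ℝ, 0 ≤ C ∧ ∀ K, ‖partialExpansion Q c (K + 1) - partialExpansion Q c K‖ ≤
      C * ‖Q‖ ^ K) ∧
    HasSum (fun K => partialExpansion Q c (K + 1) - partialExpansion Q c K)
      (qpInf Q Q * a * qpInf Q Q) := by
  have hQn := norm_nonneg Q
  have hP := geomTendsto_partialExpansion hQ hQ1 hc
  have hbound : ∃ C : ℝ, 0 ≤ C ∧ ∀ K,
      ‖partialExpansion Q c (K + 1) - partialExpansion Q c K‖ ≤ C * ‖Q‖ ^ K := by
    obtain ⟨C, hC0, hC⟩ := hP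
    have hQpos := norm_pos_iff.2 hQ0
    set P := partialExpansion Q c
    refine ⟨‖P 1 - P 0‖ + (C + C / ‖Q‖), by positivity, fun K => ?_⟩
    cases K with
    | zero =>
      have : 0 ≤ C + C / ‖Q‖ := by positivity
      simpa using this
    | succ K =>
      rw [← sub_sub_sub_cancel_right _ _ (qpInf Q Q * a * qpInf Q Q)]
      calc _ ≤ C * ‖Q‖ ^ (K + 1) + C * ‖Q‖ ^ K :=
            (norm_sub_le _ _).trans (add_le_add (hC (K + 1)) (hC K))
        _ = (C + C / ‖Q‖) * ‖Q‖ ^ (K + 1) := by field_simp; ring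
        _ ≤ _ := mul_le_mul_of_nonneg_right (le_add_of_nonneg_left (norm_nonneg _)) (by positivity)
  refine ⟨hbound, ?_⟩
  obtain ⟨C, hC0, hC⟩ := hbound
  have hs : Summable (fun K => partialExpansion Q c (K + 1) - partialExpansion Q c K) :=
    Summable.of_norm_bounded ((summable_geometric_of_lt_one hQn hQ).mul_left C) hC
  rw [hs.hasSum_iff_tendsto_nat]
  simp only [Finset.sum_range_sub]
  have h0 : partialExpansion Q c 0 = 0 := Finset.sum_range_zero _
  simp only [h0, sub_zero]
  exact (Filter.tendsto_add_atTop_iff_nat 1).1 (hP.tendsto hQn hQ)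

@[to_additive]
lemma prod_prod_eq_prod_pairs_mul {M : Type*} [CommMonoid M] {n : ℕ} (g : Fin n → Fin n → M) :
    ∏ r, ∏ s, g r s = (∏ r, ∏ s, if r < s then g r s * g s r else 1) * ∏ r, g r r := by
  have h1 : ∏ r, g r r = ∏ r, ∏ s, if r = s then g r s else 1 := by simp
  have h2 : (∏ r, ∏ s, if r < s then g s r else 1) = ∏ r, ∏ s, if s < r then g r s else 1 :=
    Finset.prod_comm
  have h3 : (∏ r, ∏ s, if r < s then g r s * g s r else 1) =
      (∏ r, ∏ s, if r < s then g r s else 1) * ∏ r, ∏ s, if s < r then g r s else 1 := by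
    rw [← h2]
    simp only [← Finset.prod_mul_distrib]
    refine Finset.prod_congr rfl fun r _ => Finset.prod_congr rfl fun s _ => ?_
    split_ifs <;> simp
  rw [h1, h3]
  simp only [← Finset.prod_mul_distrib]
  refine Finset.prod_congr rfl fun r _ => Finset.prod_congr rfl fun s _ => ?_
  rcases lt_trichotomy r s with h | h | h
  · simp [h, h.not_gt, h.ne]
  · simp [h]
  · simp [h, h.not_gt, h.ne']

lemma two_mul_choose_two (m : ℕ) : 2 * ((m.choose 2 : ℕ) : ℤ) = (m : ℤ) ^ 2 - m := by
  induction m with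
  | zero => simp
  | succ m ih =>
    rw [Nat.choose_succ_succ' m 1, Nat.choose_one_right]
    push_cast
    linarith

lemma card_mul_sum_choose_two {n : ℕ} (k : Fin n → ℕ) :
    ((n * ∑ r, (k r).choose 2 : ℕ) : ℤ) = (((∑ r, k r).choose 2 : ℕ) : ℤ) +
      ∑ r, ∑ s, if r < s then (((k r).choose 2 : ℕ) : ℤ) + ((k s).choose 2 : ℕ) - k r * k s
        else 0 := by
  have h := sum_sum_eq_sum_pairs_add fun r s : Fin n => 2 * (((k r).choose 2 : ℕ) : ℤ) - k r * k s
  have h1 : ∑ r, ∑ s : Fin n, (2 * (((k r).choose 2 : ℕ) : ℤ) - k r * k s) =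
      2 * (n * ∑ r, ((k r).choose 2 : ℤ)) - (∑ r, (k r : ℤ)) ^ 2 := by
    rw [sq, Finset.sum_mul_sum]
    simp only [Finset.sum_sub_distrib]
    congr 1
    simp only [Finset.sum_const, Finset.card_univ, Fintype.card_fin, nsmul_eq_mul, Finset.mul_sum]
    exact Finset.sum_congr rfl fun _ _ => by ring
  have h2 : ∑ r : Fin n, (2 * (((k r).choose 2 : ℕ) : ℤ) - k r * k r) = -∑ r, (k r : ℤ) := by
    rw [← Finset.sum_neg_distrib]
    exact Finset.sum_congr rfl fun r _ => by rw [two_mul_choose_two]; ring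
  have h3 : (∑ r : Fin n, ∑ s, if r < s then
        2 * (((k r).choose 2 : ℕ) : ℤ) - k r * k s + (2 * (((k s).choose 2 : ℕ) : ℤ) - k s * k r)
        else 0) =
      2 * ∑ r, ∑ s, if r < s then (((k r).choose 2 : ℕ) : ℤ) + ((k s).choose 2 : ℕ) - k r * k s
        else 0 := by
    simp only [Finset.mul_sum]
    refine Finset.sum_congr rfl fun r _ => Finset.sum_congr rfl fun s _ => ?_
    split_ifs
    · ring
    · simp
  have h4 := two_mul_choose_two (∑ r, k r)
  rw [h1, h2, h3] at h
  push_cast at h h4 ⊢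
  linarith

open Filter Topology in
lemma exists_pow_mul_pow_choose_two_le {p t : ℝ} (hp0 : 0 < p) (hp1 : p < 1) (ht : 0 < t) :
    ∃ C : ℝ, 0 ≤ C ∧ ∀ j : ℕ, t ^ j * p ^ (j.choose 2) ≤ C := by
  have hs : Summable fun j : ℕ => t ^ j * p ^ (j.choose 2) := by
    refine summable_of_ratio_test_tendsto_lt_one zero_lt_one
      (Eventually.of_forall fun j => by positivity) ?_
    have : Tendsto (fun j : ℕ => t * p ^ j) atTop (𝓝 0) := by
      simpa using (tendsto_pow_atTop_nhds_zero_of_lt_one hp0.le hp1).const_mul t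
    refine this.congr fun j => ?_
    rw [Real.norm_of_nonneg (by positivity), Real.norm_of_nonneg (by positivity),
      Nat.choose_succ_succ' j 1, Nat.choose_one_right]
    field_simp
    ring
  exact ⟨∑' j : ℕ, t ^ j * p ^ (j.choose 2), tsum_nonneg fun _ => by positivity,
    fun j => hs.le_tsum j fun _ _ => by positivity⟩

lemma exists_zpow_mul_zpow_le {p t : ℝ} (hp0 : 0 < p) (hp1 : p < 1) (ht : 0 < t) :
    ∃ C : ℝ, 0 ≤ C ∧ ∀ a b : ℕ, p ^ b * (t ^ ((a : ℤ) - b) *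
      p ^ (((a.choose 2 : ℕ) : ℤ) + (b.choose 2 : ℕ) - a * b)) ≤ C := by
  obtain ⟨C, hC0, hC⟩ := exists_pow_mul_pow_choose_two_le hp0 hp1 ht
  obtain ⟨D, hD0, hD⟩ := exists_pow_mul_pow_choose_two_le hp0 hp1 (inv_pos.2 ht)
  refine ⟨C + D, by positivity, fun a b => ?_⟩
  have ha := two_mul_choose_two a
  have hb := two_mul_choose_two b
  rcases le_total b a with h | h
  · obtain ⟨d, rfl⟩ := Nat.exists_eq_add_of_le h
    have hd := two_mul_choose_two d
    refine le_trans (le_of_eq ?_) ((hC d).trans (le_add_of_nonneg_right hD0))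
    rw [mul_left_comm, ← zpow_natCast p b, ← zpow_add₀ hp0.ne', ← zpow_natCast t d,
      ← zpow_natCast p (d.choose 2)]
    congr 2
    · push_cast; ring
    · push_cast at ha hb hd ⊢
      linarith
  · obtain ⟨d, rfl⟩ := Nat.exists_eq_add_of_le h
    have hd := two_mul_choose_two d
    refine le_trans ?_ ((hD d).trans (le_add_of_nonneg_left hC0))
    rw [mul_left_comm, ← zpow_natCast p (a + d), ← zpow_add₀ hp0.ne', inv_pow,
      ← zpow_natCast t d, ← zpow_neg, ← zpow_natCast p (d.choose 2)]
    rw [show (a : ℤ) - (a + d : ℕ) = -d by push_cast; ring]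
    refine mul_le_mul_of_nonneg_left (zpow_le_zpow_right_of_le_one₀ hp0 hp1.le ?_) (by positivity)
    push_cast at ha hb hd ⊢
    linarith

lemma exists_pair_le {Q : ℂ} (hQ0 : Q ≠ 0) (hQ : ‖Q‖ < 1) {y z : ℂ} (hy : y ≠ 0) (hz : z ≠ 0) :
    ∃ C : ℝ, 0 ≤ C ∧ ∀ a b : ℕ, ‖(z * Q ^ b - y * Q ^ a) / (z - y)‖ *
      (‖y‖ ^ ((a : ℤ) - b) * ‖z‖ ^ ((b : ℤ) - a) *
      ‖Q‖ ^ (((a.choose 2 : ℕ) : ℤ) + (b.choose 2 : ℕ) - a * b)) ≤ C := by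
  have hp := norm_pos_iff.2 hQ0
  have hy' := norm_pos_iff.2 hy
  have hz' := norm_pos_iff.2 hz
  obtain ⟨C, hC0, hC⟩ := exists_zpow_mul_zpow_le hp hQ (div_pos hy' hz')
  obtain ⟨D, hD0, hD⟩ := exists_zpow_mul_zpow_le hp hQ (div_pos hz' hy')
  refine ⟨(‖z‖ * C + ‖y‖ * D) / ‖z - y‖, by positivity, fun a b => ?_⟩
  rw [norm_div, div_mul_eq_mul_div]
  gcongr
  set e := (((a.choose 2 : ℕ) : ℤ) + (b.choose 2 : ℕ) - a * b) with he
  have h1 : ‖y‖ ^ ((a : ℤ) - b) * ‖z‖ ^ ((b : ℤ) - a) = (‖y‖ / ‖z‖) ^ ((a : ℤ) - b) := by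
    rw [div_zpow, ← neg_sub (a : ℤ) b, zpow_neg, div_eq_mul_inv]
  have h2 : (‖y‖ / ‖z‖) ^ ((a : ℤ) - b) = (‖z‖ / ‖y‖) ^ ((b : ℤ) - a) := by
    rw [← neg_sub (b : ℤ) a, zpow_neg, ← inv_zpow, inv_div]
  have hCab := hC a b
  have hDba := hD b a
  rw [add_comm ((b.choose 2 : ℕ) : ℤ), mul_comm (b : ℤ), ← he, ← h2] at hDba
  rw [h1]
  calc _ ≤ (‖z‖ * ‖Q‖ ^ b + ‖y‖ * ‖Q‖ ^ a) * ((‖y‖ / ‖z‖) ^ ((a : ℤ) - b) * ‖Q‖ ^ e) := by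
        gcongr
        refine (norm_sub_le _ _).trans (le_of_eq ?_)
        simp only [norm_mul, norm_pow]
    _ = ‖z‖ * (‖Q‖ ^ b * ((‖y‖ / ‖z‖) ^ ((a : ℤ) - b) * ‖Q‖ ^ e)) +
        ‖y‖ * (‖Q‖ ^ a * ((‖y‖ / ‖z‖) ^ ((a : ℤ) - b) * ‖Q‖ ^ e)) := by ring
    _ ≤ _ := by gcongr

lemma zpow_finset_sum {ι : Type*} {t : ℝ} (ht : t ≠ 0) (s : Finset ι) (f : ι → ℤ) :
    t ^ (∑ i ∈ s, f i) = ∏ i ∈ s, t ^ f i := by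
  classical
  induction s using Finset.induction_on with
  | empty => simp
  | insert a s ha ih => rw [Finset.sum_insert ha, Finset.prod_insert ha, zpow_add₀ ht, ih]

lemma exists_norm_anTerm_topPoly_le {n : ℕ} {Q : ℂ} (hQ0 : Q ≠ 0) (hQ : ‖Q‖ < 1)
    {x : Fin n → ℂ} (hx0 : ∀ r, x r ≠ 0)
    (hD : ∀ r s l, 1 - x r * Q ^ (l + 1) / x s ≠ 0) :
    ∃ C : ℝ, 0 ≤ C ∧ ∀ k : Fin n → ℕ, ‖anTerm Q x (topPoly x) k‖ ≤
      C * ‖Q‖ ^ ((∑ r, k r).choose 2) := by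
  have hp := norm_pos_iff.2 hQ0
  choose A hA0 hA using fun r s => exists_pair_le hQ0 hQ (hx0 r) (hx0 s)
  choose B hB0 hB using fun r s => exists_norm_inv_qp_le (z := Q * x r / x s) hQ fun l => by
    have := hD r s l
    rwa [show x r * Q ^ (l + 1) / x s = Q * x r / x s * Q ^ l by ring] at this
  refine ⟨(∏ r, ∏ s, if r < s then A r s else 1) * ∏ r, ∏ s, B r s, ?_, fun k => ?_⟩
  · refine mul_nonneg (Finset.prod_nonneg fun r _ => Finset.prod_nonneg fun s _ => ?_)
      (Finset.prod_nonneg fun r _ => Finset.prod_nonneg fun s _ => hB0 r s)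
    split_ifs
    exacts [hA0 r s, zero_le_one]
  have hx : ∏ r : Fin n, ‖x r‖ ^ ((n : ℤ) * (k r : ℤ) - ((∑ r : Fin n, k r : ℕ) : ℤ)) =
      ∏ r, ∏ s, if r < s then ‖x r‖ ^ ((k r : ℤ) - k s) * ‖x s‖ ^ ((k s : ℤ) - k r) else 1 := by
    have h := prod_prod_eq_prod_pairs_mul fun r s : Fin n => ‖x r‖ ^ ((k r : ℤ) - k s)
    simp only [sub_self, zpow_zero, Finset.prod_const_one, mul_one] at h
    rw [← h]
    refine Finset.prod_congr rfl fun r _ => ?_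
    rw [← zpow_finset_sum (norm_pos_iff.2 (hx0 r)).ne']
    simp
  have hQe : ‖Q‖ ^ (n * ∑ r, (k r).choose 2) = ‖Q‖ ^ ((∑ r, k r).choose 2) *
      ∏ r, ∏ s, if r < s then
        ‖Q‖ ^ ((((k r).choose 2 : ℕ) : ℤ) + ((k s).choose 2 : ℕ) - k r * k s) else 1 := by
    rw [← zpow_natCast ‖Q‖ (n * _), card_mul_sum_choose_two, zpow_add₀ hp.ne', zpow_natCast,
      zpow_finset_sum hp.ne']
    congr 1
    refine Finset.prod_congr rfl fun r _ => ?_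
    rw [zpow_finset_sum hp.ne']
    refine Finset.prod_congr rfl fun s _ => ?_
    split_ifs <;> simp
  have hnorm : ‖anTerm Q x (topPoly x) k‖ = (∏ r, ∏ s, if r < s then
        ‖(x s * Q ^ k s - x r * Q ^ k r) / (x s - x r)‖ *
        (‖x r‖ ^ ((k r : ℤ) - k s) * ‖x s‖ ^ ((k s : ℤ) - k r) *
        ‖Q‖ ^ ((((k r).choose 2 : ℕ) : ℤ) + ((k s).choose 2 : ℕ) - k r * k s)) else 1) *
      (∏ r, ∏ s, ‖(qp Q (Q * x r / x s) (k r))⁻¹‖) * ‖Q‖ ^ ((∑ r, k r).choose 2) := by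
    rw [anTerm]
    simp only [Finset.prod_div_distrib]
    rw [← prod_prod_qp, prod_eval_topPoly hx0 k]
    simp only [norm_mul, norm_div, norm_prod, norm_pow, norm_zpow, norm_neg, norm_one, one_pow,
      mul_one, norm_inv, Finset.prod_inv_distrib]
    rw [hx, hQe, div_eq_mul_inv]
    have hsplit : (∏ r, ∏ s, if r < s then
        ‖x s * Q ^ k s - x r * Q ^ k r‖ / ‖x s - x r‖ *
        (‖x r‖ ^ ((k r : ℤ) - k s) * ‖x s‖ ^ ((k s : ℤ) - k r) *
        ‖Q‖ ^ ((((k r).choose 2 : ℕ) : ℤ) + ((k s).choose 2 : ℕ) - k r * k s)) else 1) =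
        (∏ r, ∏ s, ‖if r < s then (x s * Q ^ k s - x r * Q ^ k r) / (x s - x r) else 1‖) *
        ((∏ r, ∏ s, if r < s then ‖x r‖ ^ ((k r : ℤ) - k s) * ‖x s‖ ^ ((k s : ℤ) - k r) else 1) *
        ∏ r, ∏ s, if r < s then
          ‖Q‖ ^ ((((k r).choose 2 : ℕ) : ℤ) + ((k s).choose 2 : ℕ) - k r * k s) else 1) := by
      simp only [← Finset.prod_mul_distrib]
      refine Finset.prod_congr rfl fun r _ => Finset.prod_congr rfl fun s _ => ?_
      split_ifs <;> simp
    rw [hsplit]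
    ring
  rw [hnorm]
  gcongr with r _ s _ r _ s _
  · refine Finset.prod_nonneg fun r _ => Finset.prod_nonneg fun s _ => ?_
    split_ifs
    exacts [hA0 r s, zero_le_one]
  · split_ifs
    exacts [hA r s (k r) (k s), le_rfl]
  · exact hB r s (k r)

lemma summable_pow_sum {p : ℝ} (hp0 : 0 ≤ p) (hp1 : p < 1) (n : ℕ) :
    Summable fun k : Fin n → ℕ => p ^ (∑ r, k r) := by
  induction n with
  | zero => exact Summable.of_finite
  | succ n ih =>
    rw [← (Fin.consEquiv fun _ : Fin (n + 1) => ℕ).summable_iff]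
    refine ((summable_geometric_of_lt_one hp0 hp1).mul_of_nonneg ih
      (fun _ => pow_nonneg hp0 _) fun _ => pow_nonneg hp0 _).congr fun k => ?_
    simp [Fin.sum_univ_succ, pow_add]

lemma hasSum_anTerm_topPoly_mul {n : ℕ} (hn : 1 ≤ n) {Q : ℂ} (hQ0 : Q ≠ 0) (hQ : ‖Q‖ < 1)
    (hQ1 : ∀ l : ℕ, 1 - Q ^ (l + 1) ≠ 0) {x : Fin n → ℂ} (hx0 : ∀ r, x r ≠ 0)
    (hD : ∀ r s l, 1 - x r * Q ^ (l + 1) / x s ≠ 0)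
    (hy : ∀ k : Fin n → ℕ, Function.Injective fun r => x r * Q ^ k r)
    {c : ℕ → ℂ} {a : ℂ} (hc : GeomTendsto ‖Q‖ c a) :
    HasSum (fun k : Fin n → ℕ => anTerm Q x (topPoly x) k * (qp Q Q (∑ r, k r) *
      ((1 - Q ^ (2 * (∑ r, k r) + 1)) * ∑ M ∈ Finset.range (∑ r, k r + 1),
        qp Q (Q ^ (-((∑ r, k r : ℕ) : ℤ))) M * qp Q (Q ^ (∑ r, k r + 1)) M * c M * Q ^ M)))
      (qpInf Q Q * a * qpInf Q Q) := by
  set G : ℕ → ℂ := fun K => (1 - Q ^ (2 * K + 1)) * ∑ M ∈ Finset.range (K + 1),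
    qp Q (Q ^ (-(K : ℤ))) M * qp Q (Q ^ (K + 1)) M * c M * Q ^ M with hG
  obtain ⟨⟨C, hC0, hC⟩, hsum⟩ := hasSum_expansion hQ0 hQ hQ1 hc
  have hP : ∀ K, partialExpansion Q c (K + 1) - partialExpansion Q c K =
      (-1) ^ K * Q ^ (K.choose 2) * G K := fun K => by
    rw [partialExpansion_succ_sub hQ0 hQ1, hG]; ring
  simp only [hP] at hC hsum
  have hqp : ∀ K, qp Q Q K ≠ 0 := qp_ne_zero fun l => by simpa [pow_succ'] using hQ1 l
  obtain ⟨A, hA0, hA⟩ := exists_norm_anTerm_topPoly_le hQ0 hQ hx0 hD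
  obtain ⟨B, hB0, hB⟩ := exists_norm_le_of_tendsto (tendsto_qp hQ Q)
  have hsm : Summable fun k : Fin n → ℕ =>
      anTerm Q x (topPoly x) k * (qp Q Q (∑ r, k r) * G (∑ r, k r)) := by
    refine Summable.of_norm_bounded
      ((summable_pow_sum (norm_nonneg Q) hQ n).mul_left (A * (B * C))) fun k => ?_
    have h1 := hC (∑ r, k r)
    simp only [norm_mul, norm_pow, norm_neg, norm_one, one_pow, one_mul] at h1
    calc _ ≤ (A * ‖Q‖ ^ ((∑ r, k r).choose 2)) * (B * ‖G (∑ r, k r)‖) := by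
          rw [norm_mul, norm_mul]
          gcongr
          exacts [hA k, hB _]
      _ = A * (B * (‖Q‖ ^ ((∑ r, k r).choose 2) * ‖G (∑ r, k r)‖)) := by ring
      _ ≤ A * (B * (C * ‖Q‖ ^ (∑ r, k r))) := by gcongr
      _ = _ := by ring
  have hfib := hsm.hasSum.tsum_fiberwise fun k => ∑ r, k r
  have hval : ∀ K, (∑' k : (fun k : Fin n → ℕ => ∑ r, k r) ⁻¹' {K},
      anTerm Q x (topPoly x) k * (qp Q Q (∑ r, (k : Fin n → ℕ) r) *
        G (∑ r, (k : Fin n → ℕ) r))) = (-1) ^ K * Q ^ (K.choose 2) * G K := fun K => by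
    have hset : (fun k : Fin n → ℕ => ∑ r, k r) ⁻¹' {K} =
        ((Finset.univ.piAntidiag K : Finset (Fin n → ℕ)) : Set (Fin n → ℕ)) := by
      ext k
      simp
    rw [hset, Finset.tsum_subtype' (Finset.univ.piAntidiag K) fun k : Fin n → ℕ =>
      anTerm Q x (topPoly x) k * (qp Q Q (∑ r, k r) * G (∑ r, k r))]
    rw [Finset.sum_congr (g := fun k => anTerm Q x (topPoly x) k * (qp Q Q K * G K)) rfl
      fun k hk => by rw [(Finset.mem_piAntidiag.1 hk).1], ← Finset.sum_mul,
      sum_anTerm_topPoly hn hQ0 hQ1 hx0 hD hy]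
    have := hqp K
    field_simp
  simp only [hval] at hfib
  rw [← hfib.unique hsum]
  exact hsm.hasSum

theorem an_expansion_pi_q (q : ℝ) (hq0 : 0 < q) (hq1 : q < 1)
    (n : ℕ) (hn : 1 ≤ n)
    (x : Fin n → ℂ) (hx0 : ∀ r, x r ≠ 0)
    (Q : ℂ) (hQ : Q = (q : ℂ) ^ 2)
    (hx : ∀ r s : Fin n, r ≠ s → ∀ l : ℤ, x r / x s ≠ Q ^ l)
    (F : (Fin n → ℕ) → ℂ)
    (hF : F = fun k =>
      (∏ r : Fin n, ∏ s : Fin n, if r < s then (1 - Q ^ ((k r : ℤ) - (k s : ℤ)) * (x r / x s)) / (1 - x r / x s) else 1) *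
      (∏ r : Fin n, x r ^ ((n : ℤ) * (k r : ℤ) - ((∑ r : Fin n, k r) : ℤ))) *
      ((1 - Q ^ (2 * (∑ r : Fin n, k r) + 1)) * qp Q Q (∑ r : Fin n, k r) /
        ∏ r : Fin n, ∏ s : Fin n, qp Q (Q * x r / x s) (k r)) *
      ((-1 : ℂ) ^ (n * (∑ r : Fin n, k r))) *
      Q ^ ((∑ r : Fin n, (r : ℕ) * k r) + n * (∑ r : Fin n, Nat.choose (k r) 2)) *
      (((q ^ ((1 : ℝ) / 4) : ℝ)) : ℂ) *
      ∑ m ∈ Finset.Iic k,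
        (∏ r : Fin n, ∏ s : Fin n, if r < s then (1 - Q ^ ((m r : ℤ) - (m s : ℤ)) * (x r / x s)) / (1 - x r / x s) else 1) * (∏ r : Fin n, ∏ s : Fin n, qp Q (Q ^ (-(k s : ℤ)) * (x r / x s)) (m r) / qp Q (Q * x r / x s) (m r)) *
        ((qp Q (Q ^ ((∑ r : Fin n, k r) + 1)) (∑ r : Fin n, m r) * qp Q Q (∑ r : Fin n, m r)) /
          qp Q ((q : ℂ)) (∑ r : Fin n, m r) ^ 2) *
        Q ^ (∑ r : Fin n, ((r : ℕ) + 1) * m r)) :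
    Summable F ∧
      (1 - Q) * (((q ^ ((1 : ℝ) / 4) : ℝ)) : ℂ) * qpInf Q Q ^ 2 / qpInf Q ((q : ℂ)) ^ 2 =
        (1 - Q) * ∑' k : Fin n → ℕ, F k := by
  have hQr : Q = ((q ^ 2 : ℝ) : ℂ) := by rw [hQ]; push_cast; rfl
  have hQn : ‖Q‖ = q ^ 2 := by rw [hQr, Complex.norm_real, Real.norm_of_nonneg (by positivity)]
  have hQlt : ‖Q‖ < 1 := by rw [hQn]; exact pow_lt_one₀ hq0.le hq1 two_ne_zero
  have hq : ‖(q : ℂ)‖ < 1 := by rwa [Complex.norm_real, Real.norm_of_nonneg hq0.le]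
  have hQ0 : Q ≠ 0 := by rw [hQ]; exact pow_ne_zero _ (by exact_mod_cast hq0.ne')
  have hone : ∀ z : ℂ, ‖z‖ < 1 → 1 - z ≠ 0 := fun z hz h => by
    rw [← sub_eq_zero.1 h, norm_one] at hz
    exact hz.false
  have hQ1 : ∀ l : ℕ, 1 - Q ^ (l + 1) ≠ 0 := fun l => hone _ <| by
    rw [norm_pow]
    exact pow_lt_one₀ (norm_nonneg _) hQlt l.succ_ne_zero
  have hqQ : ∀ l : ℕ, 1 - (q : ℂ) * Q ^ l ≠ 0 := fun l => hone _ <| by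
    rw [norm_mul, norm_pow]
    exact mul_lt_one_of_nonneg_of_lt_one_left (norm_nonneg _) hq
      (pow_le_one₀ (norm_nonneg _) hQlt.le)
  have hD : ∀ r s l, 1 - x r * Q ^ (l + 1) / x s ≠ 0 := fun r s l h => by
    rcases eq_or_ne r s with rfl | hrs
    · rw [mul_div_right_comm, div_self (hx0 r), one_mul] at h
      exact hQ1 l h
    · refine hx r s hrs (-((l + 1 : ℕ) : ℤ)) ?_
      rw [zpow_neg, zpow_natCast, eq_comm]
      rw [mul_div_right_comm] at h
      exact inv_eq_of_mul_eq_one_left (sub_eq_zero.1 h).symm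
  have hy : ∀ k : Fin n → ℕ, Function.Injective fun r => x r * Q ^ k r := fun k r s h => by
    by_contra hrs
    refine hx r s hrs ((k s : ℤ) - k r) ?_
    have h' : x r * Q ^ k r = x s * Q ^ k s := h
    rw [zpow_sub₀ hQ0, zpow_natCast, zpow_natCast, div_eq_div_iff (hx0 s) (pow_ne_zero _ hQ0), h',
      mul_comm]
  have hgq := geomTendsto_qp hQlt (q : ℂ)
  have hq0' : qpInf Q (q : ℂ) ≠ 0 := qpInf_ne_zero hQlt hqQ
  have hqN : ∀ N, qp Q (q : ℂ) N ≠ 0 := qp_ne_zero hqQ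
  have hQN : ∀ N, qp Q Q N ≠ 0 := qp_ne_zero fun l => by simpa [pow_succ'] using hQ1 l
  have hc := (hgq.mul (norm_nonneg Q) hQlt hgq).inv (norm_nonneg Q) hQlt
    (mul_ne_zero hq0' hq0') fun N => mul_ne_zero (hqN N) (hqN N)
  have hmain := (hasSum_anTerm_topPoly_mul hn hQ0 hQlt hQ1 hx0 hD hy hc).mul_left
    (((q ^ ((1 : ℝ) / 4) : ℝ)) : ℂ)
  have hFeq : F = fun k => (((q ^ ((1 : ℝ) / 4) : ℝ)) : ℂ) * (anTerm Q x (topPoly x) k *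
      (qp Q Q (∑ r, k r) * ((1 - Q ^ (2 * (∑ r, k r) + 1)) *
        ∑ M ∈ Finset.range (∑ r, k r + 1), qp Q (Q ^ (-((∑ r, k r : ℕ) : ℤ))) M *
          qp Q (Q ^ (∑ r, k r + 1)) M * (qp Q (q : ℂ) M * qp Q (q : ℂ) M)⁻¹ * Q ^ M))) := by
    rw [hF]
    funext k
    have hin := sum_Iic_inner hQ0 hQ1 hx0 hD hy (fun M =>
      (qp Q (Q ^ ((∑ r : Fin n, k r) + 1)) M * qp Q Q M) / qp Q (q : ℂ) M ^ 2) k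
    rw [hin, anTerm_eq hQ0 hx0, prod_eval_topPoly hx0]
    rw [Finset.sum_congr (g := fun M => qp Q (Q ^ (-((∑ r, k r : ℕ) : ℤ))) M *
          qp Q (Q ^ (∑ r, k r + 1)) M * (qp Q (q : ℂ) M * qp Q (q : ℂ) M)⁻¹ * Q ^ M) rfl fun M _ => by
      have := hQN M
      have := hqN M
      field_simp]
    push_cast
    rw [pow_add Q (∑ r : Fin n, (r : ℕ) * k r)]
    ring
  rw [hFeq]
  refine ⟨hmain.summable, ?_⟩
  rw [hmain.tsum_eq]
  field_simp
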